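/- Let p < q be odd primes with q ≤ 2p + 1 and let H be a non-semisimple Hopf algebra over ℂ of dimension p·q with antipode S. Let Q be a finite-dimensional H-module which is indecomposable, projective, of odd dimension over ℂ, and which admits a ℂ-linear automorphism a with a(x • v) = S²(x) • a(v) for all x ∈ H, v ∈ Q (i.e., Q ≅ Q**). Then dim(Q) ≥ p. -/

import Mathlib

namespace HopfInt

open Coalgebra Bialgebra HopfAlgebra TensorProduct WithConv

section Conv

variable {H E : Type*} [Ring H] [HopfAlgebra ℂ H] [Ring E] [Algebra ℂ E]

lemma sum_smul_counit {x : H} {ι : Type*} (r : Coalgebra.Repr ℂ x ι) :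
    ∑ i ∈ r.index, counit (R := ℂ) (r.right i) • r.left i = x := by
  simpa only [map_sum, TensorProduct.rid_tmul, one_smul]
    using congr(TensorProduct.rid ℂ H $(sum_tmul_counit_eq (R := ℂ) r))

lemma algHom_conv_antipode (F : H →ₐ[ℂ] E) :
    toConv F.toLinearMap * toConv (F.toLinearMap ∘ₗ antipode ℂ) = 1 := by
  have h := LinearMap.algHom_comp_convMul_distrib F (toConv LinearMap.id)
    (toConv (antipode ℂ (A := H)))
  rw [LinearMap.id_mul_antipode] at h
  refine WithConv.ext ?_
  simp only [LinearMap.comp_id] at h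
  rw [← h]
  ext x
  simp [LinearMap.convOne_def]

lemma antipode_conv_algHom (F : H →ₐ[ℂ] E) :
    toConv (F.toLinearMap ∘ₗ antipode ℂ) * toConv F.toLinearMap = 1 := by
  have h := LinearMap.algHom_comp_convMul_distrib F (toConv (antipode ℂ (A := H)))
    (toConv LinearMap.id)
  rw [LinearMap.antipode_mul_id] at h
  refine WithConv.ext ?_
  simp only [LinearMap.comp_id] at h
  rw [← h]
  ext x
  simp [LinearMap.convOne_def]

/-- If `G` acts on `z` through the counit, the right convolution factor `G` is absorbed by `z`. -/
lemma conv_mul_of_counit (F G : WithConv (H →ₗ[ℂ] E)) (z : E)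
    (hz : ∀ y, G y * z = counit (R := ℂ) y • z) (x : H) : (F * G) x * z = F x * z := by
  rw [(ℛ ℂ x).convMul_apply, Finset.sum_mul]
  conv_rhs => rw [← sum_smul_counit (ℛ ℂ x), map_sum, Finset.sum_mul]
  exact Finset.sum_congr rfl fun i _ => by rw [mul_assoc, hz, map_smul]; simp

end Conv

section Operators

variable {H : Type*} [Ring H] [HopfAlgebra ℂ H]

/-- The operator `x ↦ f(x₁) x₂`. -/
noncomputable def lact (f : H →ₗ[ℂ] ℂ) : Module.End ℂ H :=
  (TensorProduct.lid ℂ H).toLinearMap ∘ₗ f.rTensor H ∘ₗ comul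

/-- The operator `x ↦ x₁ f(x₂)`. -/
noncomputable def ract (f : H →ₗ[ℂ] ℂ) : Module.End ℂ H :=
  (TensorProduct.rid ℂ H).toLinearMap ∘ₗ f.lTensor H ∘ₗ comul

lemma lact_apply (f : H →ₗ[ℂ] ℂ) {x : H} {ι : Type*} (r : Coalgebra.Repr ℂ x ι) :
    lact f x = ∑ i ∈ r.index, f (r.left i) • r.right i := by
  simp [lact, ← r.eq]

lemma ract_apply (f : H →ₗ[ℂ] ℂ) {x : H} {ι : Type*} (r : Coalgebra.Repr ℂ x ι) :
    ract f x = ∑ i ∈ r.index, f (r.right i) • r.left i := by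
  simp [ract, ← r.eq]

lemma comul_lact (f : H →ₗ[ℂ] ℂ) (x : H) :
    comul (lact f x) = (lact f).rTensor H (comul (R := ℂ) x) := by
  have e : (comul : H →ₗ[ℂ] H ⊗[ℂ] H) ∘ₗ (TensorProduct.lid ℂ H).toLinearMap ∘ₗ f.rTensor H =
      (TensorProduct.lid ℂ H).toLinearMap.rTensor H ∘ₗ (f.rTensor H).rTensor H ∘ₗ
        (TensorProduct.assoc ℂ H H H).symm.toLinearMap ∘ₗ comul.lTensor H := by
    ext a b
    simp
    rw [← (ℛ ℂ b).eq]
    simp [tmul_sum, Finset.smul_sum, TensorProduct.smul_tmul']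
  have := LinearMap.congr_fun e (comul x)
  simp only [LinearMap.comp_apply, LinearEquiv.coe_coe, coassoc_symm_apply] at this
  rw [lact]
  simp only [LinearMap.comp_apply, LinearEquiv.coe_coe, this, LinearMap.rTensor_comp]

lemma comul_ract (f : H →ₗ[ℂ] ℂ) (x : H) :
    comul (ract f x) = (ract f).lTensor H (comul (R := ℂ) x) := by
  have e : (comul : H →ₗ[ℂ] H ⊗[ℂ] H) ∘ₗ (TensorProduct.rid ℂ H).toLinearMap ∘ₗ f.lTensor H =
      (TensorProduct.rid ℂ H).toLinearMap.lTensor H ∘ₗ (f.lTensor H).lTensor H ∘ₗ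
        (TensorProduct.assoc ℂ H H H).toLinearMap ∘ₗ comul.rTensor H := by
    ext a b
    simp
    rw [← (ℛ ℂ a).eq]
    simp [sum_tmul, Finset.smul_sum, TensorProduct.smul_tmul']
  have := LinearMap.congr_fun e (comul x)
  simp only [LinearMap.comp_apply, LinearEquiv.coe_coe, coassoc_apply] at this
  rw [ract]
  simp only [LinearMap.comp_apply, LinearEquiv.coe_coe, this, LinearMap.lTensor_comp]

lemma lact_ract_comm (f g : H →ₗ[ℂ] ℂ) : lact f * ract g = ract g * lact f := by
  ext x
  have e : (TensorProduct.lid ℂ H).toLinearMap ∘ₗ f.rTensor H ∘ₗ (ract g).lTensor H =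
     ract g ∘ₗ (TensorProduct.lid ℂ H).toLinearMap ∘ₗ f.rTensor H := by
    ext a b; simp
  have := LinearMap.congr_fun e (comul x)
  simp only [LinearMap.comp_apply] at this
  rw [← comul_ract] at this
  exact this

lemma lact_counit : lact (counit (R := ℂ) (A := H)) = 1 := by
  ext x; simp [lact]

lemma ract_counit : ract (counit (R := ℂ) (A := H)) = 1 := by
  ext x; simp [ract]

lemma lact_mul (f g : H →ₗ[ℂ] ℂ) : lact f * lact g = lact (f ∘ₗ lact g) := by
  ext x
  simp only [Module.End.mul_apply]
  conv_lhs => rw [lact]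
  conv_rhs => rw [lact]
  simp only [LinearMap.comp_apply, comul_lact, LinearMap.rTensor_comp]

lemma ract_mul (f g : H →ₗ[ℂ] ℂ) : ract f * ract g = ract (f ∘ₗ ract g) := by
  ext x
  simp only [Module.End.mul_apply]
  conv_lhs => rw [ract]
  conv_rhs => rw [ract]
  simp only [LinearMap.comp_apply, comul_ract, LinearMap.lTensor_comp]

lemma counit_ract (f : H →ₗ[ℂ] ℂ) (x : H) : counit (R := ℂ) (ract f x) = f x := by
  conv_rhs => rw [← sum_counit_smul (ℛ ℂ x)]
  simp [ract_apply f (ℛ ℂ x), mul_comm]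

end Operators

section Comul

variable {H : Type*} [Ring H] [HopfAlgebra ℂ H]

/-- The inclusion `x ↦ x ⊗ 1`. -/
noncomputable abbrev incL (H : Type*) [Ring H] [HopfAlgebra ℂ H] : H →ₐ[ℂ] H ⊗[ℂ] H :=
  Algebra.TensorProduct.includeLeft

/-- The inclusion `x ↦ 1 ⊗ x`. -/
noncomputable abbrev incR (H : Type*) [Ring H] [HopfAlgebra ℂ H] : H →ₐ[ℂ] H ⊗[ℂ] H :=
  Algebra.TensorProduct.includeRight

lemma incL_conv_incR : toConv (incL H).toLinearMap * toConv (incR H).toLinearMap =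
    toConv (comul (R := ℂ) (A := H)) := by
  ext x
  rw [(ℛ ℂ x).convMul_apply]
  simp [(ℛ ℂ x).eq]

lemma antipode_incL_conv_comul :
    toConv ((incL H).toLinearMap ∘ₗ antipode ℂ) * toConv (comul (R := ℂ) (A := H)) =
      toConv (incR H).toLinearMap := by
  rw [← incL_conv_incR, ← mul_assoc, antipode_conv_algHom, one_mul]

lemma comul_conv_antipode_incR :
    toConv (comul (R := ℂ) (A := H)) * toConv ((incR H).toLinearMap ∘ₗ antipode ℂ) =
      toConv (incL H).toLinearMap := by
  rw [← incL_conv_incR, mul_assoc, algHom_conv_antipode, mul_one]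

lemma comul_antipode_eq_conv :
    toConv (comul ∘ₗ antipode ℂ) = toConv ((incR H).toLinearMap ∘ₗ antipode ℂ) *
      toConv ((incL H).toLinearMap ∘ₗ antipode ℂ) := by
  symm
  refine left_inv_eq_right_inv (a := toConv (comul (R := ℂ) (A := H))) ?_
    (algHom_conv_antipode (comulAlgHom ℂ H))
  rw [mul_assoc, antipode_incL_conv_comul, antipode_conv_algHom]

lemma comul_antipode (x : H) : comul (antipode ℂ x) =
    TensorProduct.map (antipode ℂ) (antipode ℂ) (TensorProduct.comm ℂ H H (comul x)) := by
  have := congr($(comul_antipode_eq_conv (H := H)) x)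
  rw [(ℛ ℂ x).convMul_apply] at this
  refine Eq.trans this ?_
  conv_rhs => rw [← (ℛ ℂ x).eq]
  simp

lemma incR_conv_comul_antipode :
    toConv (incR H).toLinearMap * toConv (comul ∘ₗ antipode ℂ (A := H)) =
      toConv ((incL H).toLinearMap ∘ₗ antipode ℂ) := by
  rw [comul_antipode_eq_conv, ← mul_assoc, algHom_conv_antipode, one_mul]

end Comul

lemma sum_repr_mul_apply {V ι : Type*} [AddCommGroup V] [Module ℂ V] [Fintype ι]
    (b : Module.Basis ι ℂ V) (f : V →ₗ[ℂ] ℂ) (v : V) : ∑ k, b.repr v k * f (b k) = f v := by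
  conv_rhs => rw [← b.sum_repr v]
  simp only [map_sum, map_smul, smul_eq_mul]

section Integrals

variable {H : Type*} [Ring H] [HopfAlgebra ℂ H]

/-- Right integrals in the dual of `H`: functionals with `f(x₁) x₂ = f(x) 1`. -/
def IsRightIntegral (f : H →ₗ[ℂ] ℂ) : Prop := ∀ x, lact f x = f x • 1

/-- Left integrals in `H`. -/
def IsLeftIntegral (t : H) : Prop := ∀ x, x * t = counit (R := ℂ) x • t

lemma apply_lact (f p : H →ₗ[ℂ] ℂ) (x : H) : p (lact f x) = f (ract p x) := by
  simp [lact_apply f (ℛ ℂ x), ract_apply p (ℛ ℂ x), mul_comm]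

lemma sum_tmul_mul_comul_antipode {x : H} {ι : Type*} (r : Coalgebra.Repr ℂ x ι) :
    ∑ i ∈ r.index, ((1 : H) ⊗ₜ[ℂ] r.left i) * comul (antipode ℂ (r.right i)) =
      antipode ℂ x ⊗ₜ[ℂ] 1 := by
  have := congr($(incR_conv_comul_antipode (H := H)) x)
  rw [r.convMul_apply] at this
  exact this

lemma sum_tmul_mul_comul_antipode_sq {x : H} {ι : Type*} (r : Coalgebra.Repr ℂ x ι) :
    ∑ i ∈ r.index, ((1 : H) ⊗ₜ[ℂ] antipode ℂ (r.right i)) *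
      comul (antipode ℂ (antipode ℂ (r.left i))) = antipode ℂ (antipode ℂ x) ⊗ₜ[ℂ] 1 := by
  let r' : Coalgebra.Repr ℂ (antipode ℂ x) ι :=
    { index := r.index
      left := fun i => antipode ℂ (r.right i)
      right := fun i => antipode ℂ (r.left i)
      eq := by rw [comul_antipode, ← r.eq]; simp }
  exact sum_tmul_mul_comul_antipode r'

/-- The functional `x ↦ tr (y ↦ f(S²(y)₁ x₁) S²(y)₂ x₂)`. -/
noncomputable def integralOf (f : H →ₗ[ℂ] ℂ) : H →ₗ[ℂ] ℂ :=
  LinearMap.trace ℂ H ∘ₗ LinearMap.mulLeft ℂ (lact f) ∘ₗ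
    LinearMap.mulRight ℂ (antipode ℂ * antipode ℂ : Module.End ℂ H) ∘ₗ (LinearMap.mul ℂ H).flip

lemma integralOf_apply (f : H →ₗ[ℂ] ℂ) (x : H) : integralOf f x =
    LinearMap.trace ℂ H (lact f * ((LinearMap.mul ℂ H).flip x * (antipode ℂ * antipode ℂ))) := by
  simp [integralOf, mul_assoc]

lemma mulRight_ract {ι : Type*} [Fintype ι] (b : Module.Basis ι ℂ H) (p : H →ₗ[ℂ] ℂ) (x : H) :
    (LinearMap.mul ℂ H).flip (ract p x) * (antipode ℂ * antipode ℂ : Module.End ℂ H) =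
      ∑ k, ract (b.coord k) * ((LinearMap.mul ℂ H).flip x * (antipode ℂ * antipode ℂ)) *
        ract (p ∘ₗ LinearMap.mulRight ℂ (b k) ∘ₗ antipode ℂ) := by
  ext c
  have h1 : ∀ (s : H) (z : H ⊗[ℂ] H),
      TensorProduct.rid ℂ H (p.lTensor H (((1 : H) ⊗ₜ[ℂ] s) * z)) =
        ∑ k, p (s * b k) • TensorProduct.rid ℂ H ((b.coord k).lTensor H z) := by
    intro s z
    induction z with
    | zero => simp
    | add z w hz hw => simp only [mul_add, map_add, hz, hw, smul_add, Finset.sum_add_distrib]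
    | tmul a y =>
      have := sum_repr_mul_apply b (p ∘ₗ LinearMap.mulLeft ℂ s) y
      simp only [LinearMap.comp_apply, LinearMap.mulLeft_apply] at this
      simp [← this, Finset.sum_smul, smul_smul, mul_comm]
  have h2 : ∀ (y : H) (z : H ⊗[ℂ] H), TensorProduct.rid ℂ H (p.lTensor H ((y ⊗ₜ[ℂ] 1) * z)) =
      y * TensorProduct.rid ℂ H (p.lTensor H z) := by
    intro y z
    induction z with
    | zero => simp
    | add z w hz hw => simp only [mul_add, map_add, hz, hw]
    | tmul a y => simp
  have h3 := congr(TensorProduct.rid ℂ H (p.lTensor H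
    ($(sum_tmul_mul_comul_antipode_sq (ℛ ℂ c)) * comul x)))
  rw [h2, Finset.sum_mul] at h3
  simp only [mul_assoc, ← Bialgebra.comul_mul, map_sum, h1] at h3
  rw [Finset.sum_comm] at h3
  refine h3.symm.trans ?_
  rw [LinearMap.sum_apply]
  refine Finset.sum_congr rfl fun k _ => ?_
  simp only [Module.End.mul_apply, ract_apply _ (ℛ ℂ c), map_sum, map_smul]
  rfl

lemma sum_ract_mul_ract {ι : Type*} [Fintype ι] (b : Module.Basis ι ℂ H) (p : H →ₗ[ℂ] ℂ) :
    ∑ k, ract (p ∘ₗ LinearMap.mulRight ℂ (b k) ∘ₗ antipode ℂ) * ract (b.coord k) =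
      p 1 • (1 : Module.End ℂ H) := by
  ext y
  have hk : ∀ l r : H, ∑ k, b.repr r k • p (antipode ℂ l * b k) = p (antipode ℂ l * r) := by
    exact fun l r => sum_repr_mul_apply b (p ∘ₗ LinearMap.mulLeft ℂ (antipode ℂ l)) r
  have key : ∀ w : H, ∑ k, p (antipode ℂ (ract (b.coord k) w) * b k) =
      counit (R := ℂ) w * p 1 := by
    intro w
    have := congr(p $(sum_antipode_mul_eq_smul (R := ℂ) (ℛ ℂ w)))
    rw [map_smul, smul_eq_mul] at this
    rw [← this, map_sum]
    refine Eq.trans ?_ (Finset.sum_comm.trans (Finset.sum_congr rfl fun i _ => hk _ _))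
    simp [ract_apply _ (ℛ ℂ w), Finset.sum_mul]
  rw [LinearMap.sum_apply]
  simp only [ract_mul]
  simp only [ract_apply _ (ℛ ℂ y)]
  rw [Finset.sum_comm]
  conv_rhs => rw [LinearMap.smul_apply, Module.End.one_apply, ← sum_smul_counit (ℛ ℂ y)]
  rw [Finset.smul_sum]
  refine Finset.sum_congr rfl fun i _ => ?_
  rw [← Finset.sum_smul, smul_smul, mul_comm (p 1), ← key]
  simp

variable [FiniteDimensional ℂ H]

lemma isRightIntegral_integralOf (f : H →ₗ[ℂ] ℂ) : IsRightIntegral (integralOf f) := by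
  intro x
  rw [← sub_eq_zero]
  refine (Module.forall_dual_apply_eq_zero_iff ℂ _).1 fun p => ?_
  rw [map_sub, sub_eq_zero, apply_lact, map_smul, smul_eq_mul]
  let b := Module.finBasis ℂ H
  rw [integralOf_apply, mulRight_ract b, Finset.mul_sum, map_sum, integralOf_apply]
  have : ∀ k, LinearMap.trace ℂ H (lact f * (ract (b.coord k) *
      ((LinearMap.mul ℂ H).flip x * (antipode ℂ * antipode ℂ)) *
        ract (p ∘ₗ LinearMap.mulRight ℂ (b k) ∘ₗ antipode ℂ))) =
      LinearMap.trace ℂ H ((ract (p ∘ₗ LinearMap.mulRight ℂ (b k) ∘ₗ antipode ℂ) *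
        ract (b.coord k)) *
          (lact f * ((LinearMap.mul ℂ H).flip x * (antipode ℂ * antipode ℂ)))) := by
    intro k
    rw [← mul_assoc, LinearMap.trace_mul_comm, ← mul_assoc (lact f), lact_ract_comm]
    simp only [mul_assoc]
  rw [Finset.sum_congr rfl fun k _ => this k, ← map_sum, ← Finset.sum_mul, sum_ract_mul_ract]
  simp [mul_comm]

lemma exists_rightIntegral_ne_zero : ∃ f : H →ₗ[ℂ] ℂ, IsRightIntegral f ∧ f ≠ 0 := by
  by_contra! hcon
  have h0 : ∀ f : H →ₗ[ℂ] ℂ, integralOf f = 0 := fun f => hcon _ (isRightIntegral_integralOf f)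
  let M : H ⊗[ℂ] H →ₗ[ℂ] H := LinearMap.mul' ℂ H ∘ₗ
    TensorProduct.map (antipode ℂ ∘ₗ antipode ℂ) (antipode ℂ) ∘ₗ
      (TensorProduct.comm ℂ H H).toLinearMap
  have hM : M ∘ₗ comul = (counit (R := ℂ) (A := H)).smulRight 1 := by
    ext y
    have := congr(antipode ℂ $(sum_mul_antipode_eq_smul (R := ℂ) (ℛ ℂ y)))
    simp only [map_sum, antipode_mul_antidistrib, map_smul, antipode_one] at this
    simp only [LinearMap.comp_apply, LinearMap.smulRight_apply, ← this]
    conv_lhs => rw [← (ℛ ℂ y).eq]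
    simp [M]
  have h1 : LinearMap.trace ℂ (H ⊗[ℂ] H) (comul ∘ₗ M) = 1 := by
    rw [LinearMap.trace_comp_comm', hM, LinearMap.trace_smulRight]
    simp
  let b := Module.finBasis ℂ H
  have hco : ∀ (i j) (z : H ⊗[ℂ] H), (b.tensorProduct b).repr z (i, j) =
      b.repr (TensorProduct.lid ℂ H ((b.coord i).rTensor H z)) j := by
    intro i j z
    induction z with
    | zero => simp
    | add z w hz hw => simp only [map_add, Finsupp.add_apply, hz, hw]
    | tmul a y => simp [mul_comm]
  have h2 : LinearMap.trace ℂ (H ⊗[ℂ] H) (comul ∘ₗ M) =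
      ∑ i, integralOf (b.coord i) (antipode ℂ (b i)) := by
    rw [LinearMap.trace_eq_matrix_trace ℂ (b.tensorProduct b), Matrix.trace, Fintype.sum_prod_type]
    refine Finset.sum_congr rfl fun i _ => ?_
    rw [integralOf_apply, LinearMap.trace_eq_matrix_trace ℂ b, Matrix.trace]
    refine Finset.sum_congr rfl fun j _ => ?_
    rw [Matrix.diag_apply, Matrix.diag_apply, LinearMap.toMatrix_apply,
      LinearMap.toMatrix_apply, hco]
    simp [M, lact]
  rw [h2] at h1
  simp [h0] at h1

end Integrals

section Nondegenerate

variable {H : Type*} [Ring H] [HopfAlgebra ℂ H]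

lemma lact_mulLeft_antipode {f : H →ₗ[ℂ] ℂ} (hf : IsRightIntegral f) (h x : H) :
    lact (f ∘ₗ LinearMap.mulLeft ℂ (antipode ℂ h)) x =
      ract (f ∘ₗ LinearMap.mulRight ℂ x ∘ₗ antipode ℂ) h := by
  have h1 : ∀ (y : H) (z : H ⊗[ℂ] H), TensorProduct.lid ℂ H (f.rTensor H (((1 : H) ⊗ₜ[ℂ] y) * z)) =
      y * TensorProduct.lid ℂ H (f.rTensor H z) := by
    intro y z
    induction z with
    | zero => simp
    | add z w hz hw => simp only [mul_add, map_add, hz, hw]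
    | tmul a b => simp
  have h2 : ∀ (y : H) (z : H ⊗[ℂ] H), TensorProduct.lid ℂ H (f.rTensor H ((y ⊗ₜ[ℂ] (1 : H)) * z)) =
      TensorProduct.lid ℂ H ((f ∘ₗ LinearMap.mulLeft ℂ y).rTensor H z) := by
    intro y z
    induction z with
    | zero => simp
    | add z w hz hw => simp only [mul_add, map_add, hz, hw]
    | tmul a b => simp
  have h3 := congr(TensorProduct.lid ℂ H (f.rTensor H
    ($(sum_tmul_mul_comul_antipode (ℛ ℂ h)) * comul x)))
  rw [h2, Finset.sum_mul] at h3
  simp only [mul_assoc, ← Bialgebra.comul_mul, map_sum, h1] at h3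
  refine h3.symm.trans ?_
  rw [ract_apply _ (ℛ ℂ h)]
  refine Finset.sum_congr rfl fun i _ => ?_
  refine Eq.trans (congrArg _ (hf (antipode ℂ ((ℛ ℂ h).right i) * x))) ?_
  simp

lemma ract_sum {ι : Type*} (s : Finset ι) (f : ι → H →ₗ[ℂ] ℂ) :
    ract (∑ i ∈ s, f i) = ∑ i ∈ s, ract (f i) := by
  ext x
  simp only [LinearMap.sum_apply, ract_apply _ (ℛ ℂ x), Finset.sum_smul]
  exact Finset.sum_comm

lemma ract_smul (c : ℂ) (f : H →ₗ[ℂ] ℂ) : ract (c • f) = c • ract f := by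
  ext x
  simp [ract_apply _ (ℛ ℂ x), Finset.smul_sum, smul_smul]

lemma sum_ract_coord_mul_ract {ι : Type*} [Fintype ι] (b : Module.Basis ι ℂ H) (f : H →ₗ[ℂ] ℂ)
    (x : H) : ∑ k, ract (b.coord k ∘ₗ LinearMap.mulRight ℂ x ∘ₗ antipode ℂ ∘ₗ antipode ℂ) *
        ract (f ∘ₗ LinearMap.mulRight ℂ (b k) ∘ₗ antipode ℂ) = f x • (1 : Module.End ℂ H) := by
  have key : ∑ k, (b.coord k ∘ₗ LinearMap.mulRight ℂ x ∘ₗ antipode ℂ ∘ₗ antipode ℂ) ∘ₗ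
      ract (f ∘ₗ LinearMap.mulRight ℂ (b k) ∘ₗ antipode ℂ) = f x • counit (R := ℂ) (A := H) := by
    ext h
    have hk : ∀ l r : H, ∑ k, b.repr (antipode ℂ (antipode ℂ l) * x) k * f (antipode ℂ r * b k) =
        f (antipode ℂ r * (antipode ℂ (antipode ℂ l) * x)) :=
      fun l r => sum_repr_mul_apply b (f ∘ₗ LinearMap.mulLeft ℂ (antipode ℂ r)) _
    have := congr(f ((antipode ℂ ($(sum_antipode_mul_eq_smul (R := ℂ) (ℛ ℂ h)))) * x))
    simp only [map_sum, antipode_mul_antidistrib, map_smul, antipode_one, Finset.sum_mul,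
      mul_assoc, smul_mul_assoc, one_mul] at this
    simp only [LinearMap.sum_apply, LinearMap.comp_apply, ract_apply _ (ℛ ℂ h), map_sum, map_smul]
    rw [Finset.sum_comm]
    simp only [LinearMap.mulRight_apply, Module.Basis.coord_apply, LinearMap.smul_apply]
    rw [smul_eq_mul, mul_comm (f x), ← smul_eq_mul, ← this]
    refine Finset.sum_congr rfl fun i _ => ?_
    rw [← hk]
    exact Finset.sum_congr rfl fun k _ => mul_comm _ _
  simp only [ract_mul]
  rw [← ract_sum, key, ract_smul, ract_counit]

variable [FiniteDimensional ℂ H]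

lemma eq_zero_of_apply_antipode_mul {f : H →ₗ[ℂ] ℂ} (hf : IsRightIntegral f) (hf0 : f ≠ 0) {h : H}
    (hh : ∀ x, f (antipode ℂ h * x) = 0) : h = 0 := by
  have h0 : f ∘ₗ LinearMap.mulLeft ℂ (antipode ℂ h) = 0 := LinearMap.ext hh
  have hN : ∀ x, ract (f ∘ₗ LinearMap.mulRight ℂ x ∘ₗ antipode ℂ) h = 0 := by
    intro x
    rw [← lact_mulLeft_antipode hf, h0]
    simp [lact]
  obtain ⟨x, hx⟩ : ∃ x, f x ≠ 0 := by
    by_contra! hc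
    exact hf0 (LinearMap.ext hc)
  have := congr($(sum_ract_coord_mul_ract (Module.finBasis ℂ H) f x) h)
  simp only [LinearMap.sum_apply, Module.End.mul_apply, hN, map_zero, Finset.sum_const_zero,
    LinearMap.smul_apply, Module.End.one_apply] at this
  exact (smul_eq_zero.1 this.symm).resolve_left hx

lemma antipode_injective : Function.Injective (antipode ℂ (A := H)) := by
  obtain ⟨f, hf, hf0⟩ := exists_rightIntegral_ne_zero (H := H)
  refine (injective_iff_map_eq_zero _).2 fun h hh => ?_
  exact eq_zero_of_apply_antipode_mul hf hf0 fun x => by rw [hh]; simp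

lemma antipode_surjective : Function.Surjective (antipode ℂ (A := H)) :=
  LinearMap.injective_iff_surjective.1 antipode_injective

lemma eq_zero_of_apply_mul_left {f : H →ₗ[ℂ] ℂ} (hf : IsRightIntegral f) (hf0 : f ≠ 0) {h : H}
    (hh : ∀ x, f (h * x) = 0) : h = 0 := by
  obtain ⟨y, rfl⟩ := antipode_surjective h
  rw [eq_zero_of_apply_antipode_mul hf hf0 hh, map_zero]

lemma eq_zero_of_apply_mul_right {f : H →ₗ[ℂ] ℂ} (hf : IsRightIntegral f) (hf0 : f ≠ 0) {h : H}
    (hh : ∀ x, f (x * h) = 0) : h = 0 := by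
  let B : H →ₗ[ℂ] (H →ₗ[ℂ] ℂ) := (LinearMap.mul ℂ H).compr₂ f
  have hB : Function.Injective B := (injective_iff_map_eq_zero _).2 fun y hy =>
    eq_zero_of_apply_mul_left hf hf0 fun x => congr($hy x)
  have hs := (LinearMap.injective_iff_surjective_of_finrank_eq_finrank
    (Subspace.dual_finrank_eq (K := ℂ) (V := H)).symm).1 hB
  refine (Module.forall_dual_apply_eq_zero_iff ℂ _).1 fun p => ?_
  obtain ⟨x, rfl⟩ := hs p
  exact hh x

lemma eq_of_apply_mul_right {f : H →ₗ[ℂ] ℂ} (hf : IsRightIntegral f) (hf0 : f ≠ 0) {h h' : H}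
    (hh : ∀ x, f (x * h) = f (x * h')) : h = h' :=
  sub_eq_zero.1 <| eq_zero_of_apply_mul_right hf hf0 fun x => by
    rw [mul_sub, map_sub, hh, sub_self]

lemma exists_apply_mul_eq_counit {f : H →ₗ[ℂ] ℂ} (hf : IsRightIntegral f) (hf0 : f ≠ 0) :
    ∃ t : H, ∀ x, f (x * t) = counit (R := ℂ) x := by
  let B : H →ₗ[ℂ] (H →ₗ[ℂ] ℂ) := (LinearMap.mul ℂ H).flip.compr₂ f
  have hB : Function.Injective B := (injective_iff_map_eq_zero _).2 fun y hy =>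
    eq_zero_of_apply_mul_right hf hf0 fun x => congr($hy x)
  obtain ⟨t, ht⟩ := (LinearMap.injective_iff_surjective_of_finrank_eq_finrank
    (Subspace.dual_finrank_eq (K := ℂ) (V := H)).symm).1 hB (counit (R := ℂ))
  exact ⟨t, fun x => congr($ht x)⟩

end Nondegenerate

/-- A right integral `lam` in the dual and an element `t` of `H` with `lam(x t) = ε(x)`; such an
element is a left integral. -/
structure IntegralPair (H : Type*) [Ring H] [HopfAlgebra ℂ H] where
  lam : H →ₗ[ℂ] ℂ
  t : H
  isRightIntegral : IsRightIntegral lam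
  lam_mul_t : ∀ x, lam (x * t) = counit (R := ℂ) x

namespace IntegralPair

variable {H : Type*} [Ring H] [HopfAlgebra ℂ H] (I : IntegralPair H)

lemma lam_t : I.lam I.t = 1 := by
  simpa using I.lam_mul_t 1

lemma lam_ne_zero : I.lam ≠ 0 := fun h => by
  simpa [h] using I.lam_t

section

variable [FiniteDimensional ℂ H]

variable (H) in
lemma nonempty : Nonempty (IntegralPair H) := by
  obtain ⟨f, hf, hf0⟩ := exists_rightIntegral_ne_zero (H := H)
  obtain ⟨t, ht⟩ := exists_apply_mul_eq_counit hf hf0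
  exact ⟨⟨f, t, hf, ht⟩⟩

lemma eq_of_lam_mul_right {h h' : H} (hh : ∀ x, I.lam (x * h) = I.lam (x * h')) : h = h' :=
  eq_of_apply_mul_right I.isRightIntegral I.lam_ne_zero hh

lemma isLeftIntegral_t : IsLeftIntegral I.t := fun x => I.eq_of_lam_mul_right fun y => by
  rw [← mul_assoc, I.lam_mul_t, mul_smul_comm, map_smul, I.lam_mul_t, Bialgebra.counit_mul,
    mul_comm,
    smul_eq_mul]

lemma eq_smul_t {u : H} (hu : IsLeftIntegral u) : u = I.lam u • I.t :=
  I.eq_of_lam_mul_right fun y => by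
    rw [hu, mul_smul_comm, map_smul, map_smul, I.lam_mul_t, smul_eq_mul, smul_eq_mul, mul_comm]

lemma isLeftIntegral_t_mul (h : H) : IsLeftIntegral (I.t * h) := fun x => by
  rw [← mul_assoc, I.isLeftIntegral_t, smul_mul_assoc]

lemma t_mul (h : H) : I.t * h = I.lam (I.t * h) • I.t := I.eq_smul_t (I.isLeftIntegral_t_mul h)

/-- The distinguished character: `t h = α(h) t`. -/
noncomputable def alpha : H →ₐ[ℂ] ℂ :=
  AlgHom.ofLinearMap (I.lam ∘ₗ LinearMap.mulLeft ℂ I.t)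
    (by simp [I.lam_t])
    (fun x y => by
      simp only [LinearMap.comp_apply, LinearMap.mulLeft_apply]
      rw [← mul_assoc, I.t_mul x, smul_mul_assoc, map_smul, smul_eq_mul, map_smul, I.lam_t,
        smul_eq_mul, mul_one])

lemma t_mul_eq (h : H) : I.t * h = I.alpha h • I.t := I.t_mul h

lemma one_tmul_mul_comul_t (h : H) :
    ((1 : H) ⊗ₜ[ℂ] h) * comul I.t = (antipode ℂ h ⊗ₜ[ℂ] (1 : H)) * comul I.t := by
  have := conv_mul_of_counit (toConv ((incL H).toLinearMap ∘ₗ antipode ℂ)) (toConv comul)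
    (comul (R := ℂ) I.t) (fun y => by
      refine Eq.trans (Bialgebra.comul_mul y I.t).symm ?_
      rw [I.isLeftIntegral_t, map_smul]) h
  rw [antipode_incL_conv_comul] at this
  exact this

lemma sum_lam_antipode_mul {ι : Type*} (r : Coalgebra.Repr ℂ I.t ι) (h : H) :
    ∑ i ∈ r.index, I.lam (antipode ℂ h * r.left i) • r.right i = h := by
  have := congr(TensorProduct.lid ℂ H (I.lam.rTensor H $(I.one_tmul_mul_comul_t h)))
  rw [← r.eq] at this
  simp only [Finset.mul_sum, Algebra.TensorProduct.tmul_mul_tmul, one_mul, map_sum,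
    LinearMap.rTensor_tmul, TensorProduct.lid_tmul] at this
  rw [← this]
  have h1 := I.isRightIntegral I.t
  rw [lact_apply _ r, I.lam_t, one_smul] at h1
  simpa [Finset.mul_sum] using congr(h * $h1)

lemma sum_lam_mul_antipode {ι : Type*} (r : Coalgebra.Repr ℂ I.t ι) (h : H) :
    ∑ i ∈ r.index, I.lam (h * r.left i) • antipode ℂ (r.right i) = h := by
  obtain ⟨y, rfl⟩ := antipode_surjective h
  simpa only [map_sum, map_smul] using congr(antipode ℂ $(I.sum_lam_antipode_mul r y))

lemma sum_lam_antipode_right {ι : Type*} (r : Coalgebra.Repr ℂ I.t ι) (x : H) :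
    ∑ i ∈ r.index, I.lam (antipode ℂ (r.right i) * x) • r.left i = x := by
  refine I.eq_of_lam_mul_right fun h => ?_
  conv_rhs => rw [← I.sum_lam_mul_antipode r h]
  simp [Finset.mul_sum, Finset.sum_mul, mul_comm]

lemma rightIntegral_eq_smul {f : H →ₗ[ℂ] ℂ} (hf : IsRightIntegral f) (x : H) :
    f x = f I.t * I.lam x := by
  conv_lhs => rw [← I.sum_lam_antipode_right (ℛ ℂ I.t) x]
  have := congr(I.lam ((antipode ℂ ($(hf I.t))) * x))
  simpa [lact_apply f (ℛ ℂ I.t), Finset.sum_mul, mul_comm] using this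

/-- The distinguished grouplike element. -/
noncomputable def g : H := ract I.lam I.t

lemma ract_lam (x : H) : ract I.lam x = I.lam x • I.g := by
  rw [← sub_eq_zero]
  refine (Module.forall_dual_apply_eq_zero_iff ℂ _).1 fun f => ?_
  have hf : IsRightIntegral (I.lam ∘ₗ lact f) := fun y => by
    rw [← lact_mul, Module.End.mul_apply, I.isRightIntegral]
    rfl
  have := I.rightIntegral_eq_smul hf x
  simp only [LinearMap.comp_apply, apply_lact] at this
  rw [map_sub, this, map_smul, g, smul_eq_mul, mul_comm, sub_self]

lemma isGroupLikeElem_g : IsGroupLikeElem ℂ I.g where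
  counit_eq_one := by rw [g, counit_ract, I.lam_t]
  comul_eq_tmul_self := by
    conv_lhs => rw [g, comul_ract]
    conv_rhs => lhs; rw [g, ract_apply _ (ℛ ℂ I.t)]
    rw [← (ℛ ℂ I.t).eq]
    simp [I.ract_lam, sum_tmul, TensorProduct.smul_tmul']

lemma comul_t_mul_tmul_one (h : H) : comul I.t * (h ⊗ₜ[ℂ] (1 : H)) =
    comul I.t * ((1 : H) ⊗ₜ[ℂ] antipode ℂ (lact I.alpha.toLinearMap h)) := by
  have := congr(comul I.t * $(congr($(comul_conv_antipode_incR (H := H)) h)))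
  rw [(ℛ ℂ h).convMul_apply, Finset.mul_sum] at this
  refine this.symm.trans ?_
  rw [lact_apply _ (ℛ ℂ h), map_sum, tmul_sum, Finset.mul_sum]
  refine Finset.sum_congr rfl fun i _ => ?_
  refine Eq.trans (b := comul (I.t * (ℛ ℂ h).left i) *
    ((1 : H) ⊗ₜ[ℂ] antipode ℂ ((ℛ ℂ h).right i))) ?_ ?_
  · rw [← mul_assoc, Bialgebra.comul_mul]
    rfl
  · rw [t_mul_eq]
    simp

lemma lam_mul_comm (u h : H) :
    I.lam (u * h) = I.lam (antipode ℂ (antipode ℂ (lact I.alpha.toLinearMap h)) * u) := by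
  have key := congr(TensorProduct.lid ℂ H (TensorProduct.map (I.lam ∘ₗ LinearMap.mulLeft ℂ u)
    (antipode ℂ) $(I.comul_t_mul_tmul_one h)))
  rw [← (ℛ ℂ I.t).eq] at key
  simp only [Finset.sum_mul, Algebra.TensorProduct.tmul_mul_tmul, mul_one, map_sum,
    TensorProduct.map_tmul,
    TensorProduct.lid_tmul, antipode_mul_antidistrib, LinearMap.comp_apply, LinearMap.mulLeft_apply,
    ← mul_smul_comm] at key
  rw [← Finset.mul_sum, I.sum_lam_mul_antipode] at key
  rw [← key]
  conv_lhs => rw [← mul_one u, ← I.sum_lam_antipode_right (ℛ ℂ I.t) 1]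
  simp [Finset.mul_sum, Finset.sum_mul, mul_assoc, mul_comm]

lemma sum_lam_mul_right {ι : Type*} (r : Coalgebra.Repr ℂ I.t ι) (h : H) :
    ∑ i ∈ r.index, I.lam (h * r.right i) • r.left i = antipode ℂ h * I.g := by
  have := congr(TensorProduct.rid ℂ H (I.lam.lTensor H $(I.one_tmul_mul_comul_t h)))
  rw [← r.eq] at this
  simpa [Finset.mul_sum, g, ract_apply _ r] using this

/-- Radford's formula, before simplification. -/
lemma antipode_lact_mul_g (k : H) :
    antipode ℂ (antipode ℂ (antipode ℂ (lact I.alpha.toLinearMap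
      (antipode ℂ (lact I.alpha.toLinearMap k))))) * I.g = I.g * k := by
  rw [← I.sum_lam_mul_right (ℛ ℂ I.t)]
  simp only [← I.lam_mul_comm]
  have := congr(TensorProduct.rid ℂ H (I.lam.lTensor H $(I.comul_t_mul_tmul_one k)))
  rw [← (ℛ ℂ I.t).eq] at this
  simp only [Finset.sum_mul, Algebra.TensorProduct.tmul_mul_tmul, mul_one, map_sum,
    LinearMap.lTensor_tmul, TensorProduct.rid_tmul] at this
  rw [← this, g, ract_apply _ (ℛ ℂ I.t), Finset.sum_mul]
  simp

end

end IntegralPair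

section Trace

variable {V : Type*} [AddCommGroup V] [Module ℂ V] [FiniteDimensional ℂ V]

lemma hasEigenvalue_of_mem_roots_charpoly {W : Module.End ℂ V} {z : ℂ}
    (hz : z ∈ W.charpoly.roots) : W.HasEigenvalue z := by
  rw [Module.End.hasEigenvalue_iff_isRoot_charpoly]
  exact (Polynomial.mem_roots'.1 hz).2

lemma pow_eq_one_of_mem_roots_charpoly {W : Module.End ℂ V} {m : ℕ} (hW : W ^ m = 1)
    {z : ℂ} (hz : z ∈ W.charpoly.roots) : z ^ m = 1 := by
  obtain ⟨v, hv⟩ := (hasEigenvalue_of_mem_roots_charpoly hz).exists_hasEigenvector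
  have h2 := hv.pow_apply m
  rw [hW, Module.End.one_apply] at h2
  exact (smul_left_injective ℂ hv.2 (h2.symm.trans (one_smul ℂ v).symm))

lemma card_roots_charpoly (W : Module.End ℂ V) :
    Multiset.card W.charpoly.roots = Module.finrank ℂ V := by
  rw [← (IsAlgClosed.splits W.charpoly).natDegree_eq_card_roots, LinearMap.charpoly_natDegree]

lemma eq_one_of_trace_eq_finrank {W : Module.End ℂ V} {m : ℕ} (hm : m ≠ 0) (hW : W ^ m = 1)
    (htr : LinearMap.trace ℂ V W = Module.finrank ℂ V) : W = 1 := by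
  have hn : ∀ z ∈ W.charpoly.roots, ‖z‖ = 1 := fun z hz =>
    Complex.norm_eq_one_of_pow_eq_one
      (pow_eq_one_of_mem_roots_charpoly hW hz) hm
  rw [Module.End.trace_eq_sum_roots_charpoly_of_splits (IsAlgClosed.splits _),
    ← card_roots_charpoly W] at htr
  have hs : ∀ s : Multiset ℂ, (∀ z ∈ s, ‖z‖ = 1) → s.sum.re ≤ Multiset.card s ∧
      (s.sum.re = Multiset.card s → ∀ z ∈ s, z = 1) := by
    intro s
    induction s using Multiset.induction with
    | empty => simp
    | cons a s ih =>
      intro h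
      have ha := h a (Multiset.mem_cons_self a s)
      obtain ⟨h1, h2⟩ := ih fun z hz => h z (Multiset.mem_cons_of_mem hz)
      have h3 : a.re ≤ 1 := ha ▸ Complex.re_le_norm a
      simp only [Multiset.sum_cons, Complex.add_re, Multiset.card_cons, Nat.cast_add, Nat.cast_one,
        Multiset.mem_cons, forall_eq_or_imp]
      refine ⟨by linarith, fun h4 => ⟨?_, h2 (by linarith)⟩⟩
      have h5 : a.re = 1 := by linarith
      have h6 := Complex.sq_norm a
      rw [ha, Complex.normSq_apply, h5] at h6
      exact Complex.ext h5 (by simpa using h6)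
  have h1 := (hs _ hn).2 (by rw [htr]; simp)
  have h2 : W.charpoly = (Polynomial.X - 1) ^ Module.finrank ℂ V := by
    rw [(IsAlgClosed.splits W.charpoly).eq_prod_roots_of_monic W.charpoly_monic,
      Multiset.map_congr rfl (g := fun _ => Polynomial.X - 1) fun z hz => by rw [h1 z hz, map_one],
      Multiset.map_const', Multiset.prod_replicate, card_roots_charpoly]
  have h3 : IsNilpotent (W - 1) := ⟨_, by
    simpa [h2] using LinearMap.aeval_self_charpoly W⟩
  have h4 : W.IsSemisimple := by
    refine Module.End.isSemisimple_of_squarefree_aeval_eq_zero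
      (p := Polynomial.X ^ m - Polynomial.C 1) ?_ (by simp [hW])
    exact (Polynomial.separable_X_pow_sub_C 1 (by exact_mod_cast hm) one_ne_zero).squarefree
  have h5 : (W - 1).IsSemisimple := by
    simpa using (Module.End.isSemisimple_sub_algebraMap_iff (μ := (1 : ℂ))).2 h4
  exact sub_eq_zero.1 (Module.End.eq_zero_of_isNilpotent_isSemisimple h3 h5)

/-- A finite-order operator all of whose powers have trace `0` or `dim V` has order dividing
`dim V`. -/
lemma pow_finrank_eq_one {U : Module.End ℂ V} (hfin : IsOfFinOrder U)
    (htr : ∀ k : ℕ, LinearMap.trace ℂ V (U ^ k) ^ 2 =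
      Module.finrank ℂ V * LinearMap.trace ℂ V (U ^ k)) : U ^ Module.finrank ℂ V = 1 := by
  have hd : 0 < orderOf U := hfin.orderOf_pos
  have hd0 : (orderOf U : ℂ) ≠ 0 := by exact_mod_cast hd.ne'
  have h0 : ∀ k, 0 < k → k < orderOf U → LinearMap.trace ℂ V (U ^ k) = 0 := by
    intro k hk hk'
    by_contra hne
    have h1 := htr k
    rw [sq] at h1
    have h2 := eq_one_of_trace_eq_finrank (W := U ^ k) hd.ne'
      (by rw [← pow_mul, mul_comm, pow_mul, pow_orderOf_eq_one, one_pow]) (mul_right_cancel₀ hne h1)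
    exact absurd (orderOf_le_of_pow_eq_one hk h2) (by omega)
  let s : Module.End ℂ V := ∑ k ∈ Finset.range (orderOf U), U ^ k
  have hUs : U * s = s := by
    have := mul_geom_sum U (orderOf U)
    rw [pow_orderOf_eq_one, sub_self, sub_mul, one_mul, sub_eq_zero] at this
    exact this
  have hUks : ∀ k, U ^ k * s = s := by
    intro k
    induction k with
    | zero => simp
    | succ k ih => rw [pow_succ, mul_assoc, hUs, ih]
  have hss : s * s = (orderOf U : ℂ) • s := by
    conv_lhs => lhs; unfold s
    rw [Finset.sum_mul]
    simp [hUks, Nat.cast_smul_eq_nsmul]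
  have htrs : LinearMap.trace ℂ V s = Module.finrank ℂ V := by
    simp only [s, map_sum]
    rw [Finset.sum_eq_single_of_mem 0 (Finset.mem_range.2 hd)]
    · simp
    · exact fun k hk hk0 => h0 k (Nat.pos_of_ne_zero hk0) (Finset.mem_range.1 hk)
  have he : IsIdempotentElem ((orderOf U : ℂ)⁻¹ • s) := by
    rw [IsIdempotentElem, smul_mul_smul_comm, hss, smul_smul]
    congr 1
    field_simp
  have h1 := (LinearMap.IsIdempotentElem.isProj_range _ he).trace
  rw [map_smul, htrs, smul_eq_mul, inv_mul_eq_iff_eq_mul₀ hd0] at h1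
  exact orderOf_dvd_iff_pow_eq_one.1 ⟨_, by exact_mod_cast h1⟩

lemma trace_eq_of_intertwine {A B T : Module.End ℂ V} (hT : Function.Injective T)
    (h : A * T = T * B) : LinearMap.trace ℂ V A = LinearMap.trace ℂ V B := by
  rw [← LinearMap.trace_conj' B (LinearEquiv.ofInjectiveEndo T hT)]
  congr 1
  ext x
  obtain ⟨y, rfl⟩ := (LinearEquiv.ofInjectiveEndo T hT).surjective x
  rw [LinearEquiv.conj_apply_apply, LinearEquiv.symm_apply_apply]
  exact congr($h y)

lemma trace_sq_of_intertwine {U : Module.End ℂ V} {T : Module.End ℂ (V ⊗[ℂ] V)}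
    (hT : Function.Injective T) (h : TensorProduct.map U U * T = T * TensorProduct.map U 1 ∨
      TensorProduct.map U 1 * T = T * TensorProduct.map U U) :
    LinearMap.trace ℂ V U ^ 2 = Module.finrank ℂ V * LinearMap.trace ℂ V U := by
  have h1 : LinearMap.trace ℂ _ (TensorProduct.map U U) =
      LinearMap.trace ℂ _ (TensorProduct.map U (1 : Module.End ℂ V)) := by
    rcases h with h | h
    · exact trace_eq_of_intertwine hT h
    · exact (trace_eq_of_intertwine hT h).symm
  rw [LinearMap.trace_tensorProduct', LinearMap.trace_tensorProduct', LinearMap.trace_one] at h1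
  rw [sq, h1, mul_comm]

end Trace

lemma isOfFinOrder_of_pow_mem_finite {M : Type*} [Monoid M] {u v : M} (huv : v * u = 1) {s : Set M}
    (hs : s.Finite) (hmem : ∀ k : ℕ, u ^ k ∈ s) : IsOfFinOrder u := by
  obtain ⟨i, -, j, -, hij, h⟩ := Set.infinite_univ.exists_ne_map_eq_of_mapsTo
    (f := fun k : ℕ => u ^ k) (fun k _ => hmem k) hs
  have hreg : ∀ k : ℕ, v ^ k * u ^ k = 1 := by
    intro k
    induction k with
    | zero => simp
    | succ k ih => rw [pow_succ, pow_succ', mul_assoc, ← mul_assoc v u, huv, one_mul, ih]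
  have key : ∀ a b : ℕ, a < b → u ^ a = u ^ b → IsOfFinOrder u := by
    intro a b hab he
    refine isOfFinOrder_iff_pow_eq_one.2 ⟨b - a, by omega, ?_⟩
    rw [← hreg a, he, ← one_mul (u ^ (b - a)), ← hreg a, mul_assoc, ← pow_add]
    congr 2
    omega
  rcases hij.lt_or_gt with hlt | hlt
  · exact key i j hlt h
  · exact key j i hlt h.symm

section Order

variable {H : Type*} [Ring H] [HopfAlgebra ℂ H]

lemma injective_mul_comul_left : Function.Injective
    (LinearMap.mul' ℂ (H ⊗[ℂ] H) ∘ₗ TensorProduct.map (incL H).toLinearMap comul) := by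
  let D : H →ₗ[ℂ] H ⊗[ℂ] H :=
    (toConv ((incL H).toLinearMap ∘ₗ antipode ℂ) * toConv (incR H).toLinearMap).ofConv
  let T := LinearMap.mul' ℂ (H ⊗[ℂ] H) ∘ₗ TensorProduct.map (incL H).toLinearMap D
  have h1 : ∀ x w, T (incL H x * w) = incL H x * T w := by
    intro x w
    induction w with
    | zero => simp
    | add z w hz hw => simp only [mul_add, map_add, hz, hw]
    | tmul a y => simp [T, ← mul_assoc]
  have h2 : ∀ y, T (comul y) = incR H y := by
    intro y
    have h : toConv (incL H).toLinearMap * toConv D = toConv (incR H).toLinearMap := by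
      rw [toConv_ofConv, ← mul_assoc, algHom_conv_antipode, one_mul]
    exact congr($h y)
  refine Function.LeftInverse.injective (g := T) fun w => ?_
  induction w with
  | zero => simp
  | add z w hz hw => simp only [map_add, hz, hw]
  | tmul a y =>
    exact (h1 a _).trans (by rw [h2]; simp)

lemma injective_mul_comul_right : Function.Injective
    (LinearMap.mul' ℂ (H ⊗[ℂ] H) ∘ₗ TensorProduct.map comul (incR H).toLinearMap) := by
  let D : H →ₗ[ℂ] H ⊗[ℂ] H :=
    (toConv (incL H).toLinearMap * toConv ((incR H).toLinearMap ∘ₗ antipode ℂ)).ofConv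
  let T := LinearMap.mul' ℂ (H ⊗[ℂ] H) ∘ₗ TensorProduct.map D (incR H).toLinearMap
  have h1 : ∀ x w, T (w * incR H x) = T w * incR H x := by
    intro x w
    induction w with
    | zero => simp
    | add z w hz hw => simp only [add_mul, map_add, hz, hw]
    | tmul a y => simp [T, mul_assoc]
  have h2 : ∀ y, T (comul y) = incL H y := by
    intro y
    have h : toConv D * toConv (incR H).toLinearMap = toConv (incL H).toLinearMap := by
      rw [toConv_ofConv, mul_assoc, antipode_conv_algHom, mul_one]
    exact congr($h y)
  refine Function.LeftInverse.injective (g := T) fun w => ?_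
  induction w with
  | zero => simp
  | add z w hz hw => simp only [map_add, hz, hw]
  | tmul a y =>
    exact (h1 y _).trans (by rw [h2]; simp)

/-- The algebra endomorphism `x ↦ φ(x₁) x₂`. -/
noncomputable def lactAlgHom (φ : H →ₐ[ℂ] ℂ) : H →ₐ[ℂ] H :=
  (Algebra.TensorProduct.lid ℂ H).toAlgHom.comp
    ((Algebra.TensorProduct.map φ (AlgHom.id ℂ H)).comp (comulAlgHom ℂ H))

lemma lactAlgHom_apply (φ : H →ₐ[ℂ] ℂ) (x : H) : lactAlgHom φ x = lact φ.toLinearMap x := by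
  change Algebra.TensorProduct.lid ℂ H (Algebra.TensorProduct.map φ (AlgHom.id ℂ H) (comul x)) = _
  rw [← (ℛ ℂ x).eq, lact_apply _ (ℛ ℂ x)]
  simp

lemma lact_algHom_pow (φ : H →ₐ[ℂ] ℂ) (k : ℕ) :
    ∃ ψ : H →ₐ[ℂ] ℂ, lact φ.toLinearMap ^ k = lact ψ.toLinearMap := by
  induction k with
  | zero => exact ⟨counitAlgHom ℂ H, lact_counit.symm⟩
  | succ k ih =>
    obtain ⟨ψ, hψ⟩ := ih
    refine ⟨φ.comp (lactAlgHom ψ), ?_⟩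
    rw [pow_succ', hψ, lact_mul]
    congr 1

lemma lact_antipode_mul_lact (φ : H →ₐ[ℂ] ℂ) :
    lact (φ.toLinearMap ∘ₗ antipode ℂ) * lact φ.toLinearMap = 1 := by
  rw [lact_mul, ← lact_counit]
  congr 1
  ext x
  have := congr($(algHom_conv_antipode φ) x)
  rw [(ℛ ℂ x).convMul_apply, LinearMap.convOne_apply] at this
  simpa [lact_apply _ (ℛ ℂ x)] using this

variable [FiniteDimensional ℂ H]

lemma finite_algHom : Finite (H →ₐ[ℂ] ℂ) :=
  (linearIndependent_toLinearMap ℂ H ℂ).finite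

lemma lact_algHom_pow_finrank (φ : H →ₐ[ℂ] ℂ) : lact φ.toLinearMap ^ Module.finrank ℂ H = 1 := by
  have := finite_algHom (H := H)
  refine pow_finrank_eq_one (isOfFinOrder_of_pow_mem_finite (lact_antipode_mul_lact φ)
    (Set.finite_range fun ψ : H →ₐ[ℂ] ℂ => lact ψ.toLinearMap) fun k => ?_) fun k => ?_
  · obtain ⟨ψ, hψ⟩ := lact_algHom_pow φ k
    exact ⟨ψ, hψ.symm⟩
  · obtain ⟨ψ, hψ⟩ := lact_algHom_pow φ k
    rw [hψ]
    refine trace_sq_of_intertwine injective_mul_comul_left (Or.inr ?_)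
    ext x y
    have hmul : ∀ (a : H) (w : H ⊗[ℂ] H),
        TensorProduct.map (lact ψ.toLinearMap) (1 : Module.End ℂ H) ((a ⊗ₜ[ℂ] (1 : H)) * w) =
        (lact ψ.toLinearMap a ⊗ₜ[ℂ] (1 : H)) * (lact ψ.toLinearMap).rTensor H w := by
      intro a w
      induction w with
      | zero => simp
      | add z w hz hw => simp only [mul_add, map_add, hz, hw]
      | tmul b c => simp [← lactAlgHom_apply]
    simp [comul_lact, hmul]

lemma pow_finrank_eq_one_of_isGroupLikeElem {g : H} (hg : IsGroupLikeElem ℂ g) :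
    g ^ Module.finrank ℂ H = 1 := by
  have hpow : ∀ k : ℕ, IsGroupLikeElem ℂ (g ^ k) := fun k => hg.pow
  have hl : ∀ k : ℕ, LinearMap.mulLeft ℂ (g ^ k) = LinearMap.mulLeft ℂ g ^ k := fun k => by
    rw [LinearMap.pow_mulLeft]
  have hfin : {x : H | IsGroupLikeElem ℂ x}.Finite :=
    (linearIndepOn_isGroupLikeElem (R := ℂ) (A := H)).setFinite
  have hord : IsOfFinOrder g := isOfFinOrder_of_pow_mem_finite hg.antipode_mul_cancel hfin hpow
  have h1 : IsOfFinOrder (LinearMap.mulLeft ℂ g) := by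
    obtain ⟨k, hk, hk1⟩ := isOfFinOrder_iff_pow_eq_one.1 hord
    exact isOfFinOrder_iff_pow_eq_one.2 ⟨k, hk, by rw [← hl, hk1, LinearMap.mulLeft_one]; rfl⟩
  have h2 := pow_finrank_eq_one h1 fun k => by
    rw [← hl]
    refine trace_sq_of_intertwine injective_mul_comul_right (Or.inl ?_)
    ext x y
    have hmul : ∀ (a : H) (w : H ⊗[ℂ] H),
        TensorProduct.map (LinearMap.mulLeft ℂ a) (LinearMap.mulLeft ℂ a) w = (a ⊗ₜ a) * w := by
      intro a w
      induction w with
      | zero => simp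
      | add z w hz hw => simp only [mul_add, map_add, hz, hw]
      | tmul b c => simp
    simp [hmul, (hpow k).comul_eq_tmul_self, mul_assoc]
  simpa [← hl] using congr($h2 1)

end Order

section Radford

variable {H : Type*} [Ring H] [HopfAlgebra ℂ H]

lemma ract_antipode (f : H →ₗ[ℂ] ℂ) :
    ract f * antipode ℂ = antipode ℂ * lact (f ∘ₗ antipode ℂ) := by
  ext x
  simp only [Module.End.mul_apply]
  conv_lhs => rw [ract, LinearMap.comp_apply, LinearMap.comp_apply, comul_antipode]
  rw [lact_apply _ (ℛ ℂ x), ← (ℛ ℂ x).eq]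
  simp

lemma lact_antipode (f : H →ₗ[ℂ] ℂ) :
    lact f * antipode ℂ = antipode ℂ * ract (f ∘ₗ antipode ℂ) := by
  ext x
  simp only [Module.End.mul_apply]
  conv_lhs => rw [lact, LinearMap.comp_apply, LinearMap.comp_apply, comul_antipode]
  rw [ract_apply _ (ℛ ℂ x), ← (ℛ ℂ x).eq]
  simp

/-- The inverse of a character in the dual. -/
noncomputable def algHomInv (φ : H →ₐ[ℂ] ℂ) : H →ₐ[ℂ] ℂ :=
  AlgHom.ofLinearMap (φ.toLinearMap ∘ₗ antipode ℂ) (by simp)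
    (fun x y => by simp [antipode_mul_antidistrib, mul_comm])

lemma algHomInv_toLinearMap (φ : H →ₐ[ℂ] ℂ) :
    (algHomInv φ).toLinearMap = φ.toLinearMap ∘ₗ antipode ℂ := rfl

lemma algHom_comp_antipode_sq (φ : H →ₐ[ℂ] ℂ) :
    φ.toLinearMap ∘ₗ antipode ℂ ∘ₗ antipode ℂ = φ.toLinearMap :=
  congr(($((left_inv_eq_right_inv (algHom_conv_antipode φ)
    (algHom_conv_antipode (algHomInv φ))).symm)).ofConv)

lemma commute_antipode_sq_lact (φ : H →ₐ[ℂ] ℂ) :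
    Commute (antipode ℂ * antipode ℂ : Module.End ℂ H) (lact φ.toLinearMap) := by
  rw [Commute, SemiconjBy, ← mul_assoc (lact _), lact_antipode, mul_assoc (antipode ℂ) (ract _),
    ract_antipode, LinearMap.comp_assoc, algHom_comp_antipode_sq, mul_assoc]

/-- Conjugation by a grouplike element. -/
noncomputable def adg (g : H) : Module.End ℂ H :=
  LinearMap.mulLeft ℂ g * LinearMap.mulRight ℂ (antipode ℂ g)

lemma adg_apply (g x : H) : adg g x = g * (x * antipode ℂ g) := rfl

lemma lact_grouplike (φ : H →ₐ[ℂ] ℂ) {g : H} (hg : IsGroupLikeElem ℂ g) :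
    lact φ.toLinearMap g = φ g • g := by
  rw [lact, LinearMap.comp_apply, LinearMap.comp_apply, hg.comul_eq_tmul_self]
  simp

lemma commute_adg_lact (φ : H →ₐ[ℂ] ℂ) {g : H} (hg : IsGroupLikeElem ℂ g) :
    Commute (adg g) (lact φ.toLinearMap) := by
  have h1 : φ (antipode ℂ g) * φ g = 1 := by
    rw [mul_comm, ← map_mul, hg.mul_antipode_cancel, map_one]
  ext x
  simp only [Module.End.mul_apply, adg_apply, ← lactAlgHom_apply, map_mul]
  simp only [lactAlgHom_apply, lact_grouplike φ hg, lact_grouplike φ hg.antipode, mul_smul_comm,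
    smul_mul_assoc, smul_smul, h1, one_smul]

lemma commute_adg_antipode {g : H} (hg : IsGroupLikeElem ℂ g) :
    Commute (adg g) (antipode ℂ) := by
  ext x
  simp [adg_apply, antipode_mul_antidistrib, hg.antipode_antipode, mul_assoc]

variable [FiniteDimensional ℂ H]

lemma commute_adg_ract (φ : H →ₐ[ℂ] ℂ) {g : H} (hg : IsGroupLikeElem ℂ g) :
    Commute (adg g) (ract φ.toLinearMap) := by
  have h : adg g * ract φ.toLinearMap * antipode ℂ = ract φ.toLinearMap * adg g * antipode ℂ := by
    rw [mul_assoc, ract_antipode, ← mul_assoc, (commute_adg_antipode hg).eq, mul_assoc,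
      ← algHomInv_toLinearMap, (commute_adg_lact _ hg).eq, ← mul_assoc, algHomInv_toLinearMap,
      ← ract_antipode, mul_assoc, ← (commute_adg_antipode hg).eq, mul_assoc]
  exact LinearMap.ext fun x => by
    obtain ⟨y, rfl⟩ := antipode_surjective x
    exact congr($h y)

lemma ract_algHom_pow_finrank (φ : H →ₐ[ℂ] ℂ) : ract φ.toLinearMap ^ Module.finrank ℂ H = 1 := by
  have h : ∀ k : ℕ, ract φ.toLinearMap ^ k * antipode ℂ =
      antipode ℂ * lact (algHomInv φ).toLinearMap ^ k := by
    intro k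
    exact (SemiconjBy.pow_right (a := antipode ℂ (A := H))
      (ract_antipode φ.toLinearMap).symm k).symm
  have hn := h (Module.finrank ℂ H)
  rw [lact_algHom_pow_finrank, mul_one] at hn
  exact LinearMap.ext fun x => by
    obtain ⟨y, rfl⟩ := antipode_surjective x
    exact congr($hn y)

lemma adg_pow_finrank {g : H} (hg : IsGroupLikeElem ℂ g) : adg g ^ Module.finrank ℂ H = 1 := by
  rw [adg, Commute.mul_pow (LinearMap.commute_mulLeft_right g (antipode ℂ g)),
    LinearMap.pow_mulLeft, LinearMap.pow_mulRight, pow_finrank_eq_one_of_isGroupLikeElem hg,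
    pow_finrank_eq_one_of_isGroupLikeElem hg.antipode, LinearMap.mulLeft_one,
    LinearMap.mulRight_one]
  rfl

lemma radford (I : IntegralPair H) :
    (antipode ℂ * antipode ℂ) ^ 2 * lact I.alpha.toLinearMap =
      adg I.g * ract I.alpha.toLinearMap := by
  have hg := I.isGroupLikeElem_g
  ext y
  obtain ⟨k, rfl⟩ : ∃ k, antipode ℂ (lact I.alpha.toLinearMap k) = y := by
    have hL : Function.Surjective (lact I.alpha.toLinearMap) :=
      LinearMap.injective_iff_surjective.1
        (Function.LeftInverse.injective (g := lact (I.alpha.toLinearMap ∘ₗ antipode ℂ))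
          fun x => congr($(lact_antipode_mul_lact I.alpha) x))
    exact (antipode_surjective.comp hL) y
  have h1 : ract I.alpha.toLinearMap (antipode ℂ (lact I.alpha.toLinearMap k)) = antipode ℂ k := by
    refine (congr($(ract_antipode I.alpha.toLinearMap) (lact I.alpha.toLinearMap k))).trans ?_
    exact congr(antipode ℂ ($(lact_antipode_mul_lact I.alpha) k))
  have h2 := congr(I.g * antipode ℂ $(I.antipode_lact_mul_g k))
  rw [antipode_mul_antidistrib, antipode_mul_antidistrib, ← mul_assoc, hg.mul_antipode_cancel,
    one_mul] at h2
  simp only [sq, Module.End.mul_apply, adg_apply, h1]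
  exact h2

lemma antipode_pow_eq_one :
    (antipode ℂ * antipode ℂ : Module.End ℂ H) ^ (2 * Module.finrank ℂ H) = 1 := by
  obtain ⟨I⟩ := IntegralPair.nonempty H
  have h := congr($(radford I) ^ Module.finrank ℂ H)
  rwa [((commute_antipode_sq_lact I.alpha).pow_left 2).mul_pow,
    (commute_adg_ract I.alpha I.isGroupLikeElem_g).mul_pow, lact_algHom_pow_finrank,
    ract_algHom_pow_finrank, adg_pow_finrank I.isGroupLikeElem_g, mul_one, mul_one, ← pow_mul] at h

end Radford

section Modules

variable {H : Type*} [Ring H] [HopfAlgebra ℂ H]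
  {M N : Type*} [AddCommGroup M] [Module ℂ M] [Module H M] [IsScalarTower ℂ H M]
  [AddCommGroup N] [Module ℂ N] [Module H N] [IsScalarTower ℂ H N]

/-- The map sending `x ⊗ y` to the conjugate `v ↦ x θ(S(y) v)` of a linear map `θ`. -/
noncomputable def sandwich (θ : M →ₗ[ℂ] N) (v : M) : H ⊗[ℂ] H →ₗ[ℂ] N :=
  TensorProduct.lift <| LinearMap.mk₂ ℂ (fun x y : H => x • θ (antipode ℂ y • v))
    (fun x x' y => add_smul _ _ _) (fun c x y => smul_assoc _ _ _)
    (fun x y y' => by simp only [map_add, add_smul, smul_add])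
    (fun c x y => by
      rw [map_smul (antipode ℂ), smul_assoc, map_smul θ, smul_comm])

lemma sandwich_tmul (θ : M →ₗ[ℂ] N) (v : M) (x y : H) :
    sandwich θ v (x ⊗ₜ y) = x • θ (antipode ℂ y • v) := rfl

lemma sandwich_tmul_one_mul (θ : M →ₗ[ℂ] N) (v : M) (h : H) (w : H ⊗[ℂ] H) :
    sandwich θ v ((h ⊗ₜ[ℂ] (1 : H)) * w) = h • sandwich θ v w := by
  induction w with
  | zero => simp
  | add z w hz hw => simp only [mul_add, map_add, hz, hw, smul_add]
  | tmul a b => simp [sandwich_tmul, mul_smul]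

lemma sandwich_one_tmul_mul (θ : M →ₗ[ℂ] N) (v : M) (h : H) (w : H ⊗[ℂ] H) :
    sandwich θ v (((1 : H) ⊗ₜ[ℂ] h) * w) = sandwich θ (antipode ℂ h • v) w := by
  induction w with
  | zero => simp
  | add z w hz hw => simp only [mul_add, map_add, hz, hw]
  | tmul a b => simp [sandwich_tmul, mul_smul, antipode_mul_antidistrib]

namespace IntegralPair

variable [FiniteDimensional ℂ H] (I : IntegralPair H)

/-- The `H`-linear average of a linear map with respect to the integral. -/
noncomputable def average (θ : M →ₗ[ℂ] N) : M →ₗ[H] N where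
  toFun v := sandwich θ v (comul I.t)
  map_add' v w := by
    rw [← (ℛ ℂ I.t).eq]
    simp [sandwich_tmul, Finset.sum_add_distrib]
  map_smul' h v := by
    obtain ⟨k, rfl⟩ := antipode_surjective h
    rw [← sandwich_one_tmul_mul, I.one_tmul_mul_comul_t, sandwich_tmul_one_mul]
    rfl

lemma average_apply (θ : M →ₗ[ℂ] N) (v : M) : I.average θ v =
    ∑ i ∈ (ℛ ℂ I.t).index, (ℛ ℂ I.t).left i • θ (antipode ℂ ((ℛ ℂ I.t).right i) • v) := by
  change sandwich θ v (comul I.t) = _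
  rw [← (ℛ ℂ I.t).eq]
  simp [sandwich_tmul]

lemma isSemisimpleRing_of_counit_ne_zero (h : counit (R := ℂ) I.t ≠ 0) : IsSemisimpleRing H := by
  refine (isSemisimpleModule_iff H H).2 ⟨fun p => ?_⟩
  obtain ⟨π, hπ⟩ := (p.restrictScalars ℂ).subtype.exists_leftInverse_of_injective
    (Submodule.ker_subtype _)
  let π' : H →ₗ[ℂ] p := π
  have hπ' : ∀ x : p, π' x = x := fun x => congr($hπ x)
  refine ⟨_, LinearMap.isCompl_of_proj (f := (counit (R := ℂ) I.t)⁻¹ • I.average π') fun x => ?_⟩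
  rw [LinearMap.smul_apply, inv_smul_eq_iff₀ h, average_apply]
  have h1 : ∀ y : H, π' (y • (x : H)) = y • x := fun y => hπ' (y • x)
  simp only [h1, ← mul_smul, ← Finset.sum_smul, sum_mul_antipode_eq_smul]
  rw [smul_assoc, one_smul]

variable {Q : Type*} [AddCommGroup Q] [Module ℂ Q] [Module H Q] [IsScalarTower ℂ H Q]

lemma exists_average_eq_id [Module.Projective H Q] :
    ∃ θ : Q →ₗ[ℂ] Q, I.average θ = (LinearMap.id : Q →ₗ[H] Q) := by
  obtain ⟨s, hs⟩ := Module.Projective.out (R := H) (P := Q)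
  let π := Finsupp.linearCombination H (id : Q → Q)
  let e : (Q →₀ H) →ₗ[ℂ] (Q →₀ H) := Finsupp.mapRange.linearMap (I.lam.smulRight 1)
  refine ⟨π.restrictScalars ℂ ∘ₗ e ∘ₗ s.restrictScalars ℂ, ?_⟩
  ext v
  rw [average_apply, LinearMap.id_apply]
  conv_rhs => rw [← hs v]
  simp only [LinearMap.comp_apply, LinearMap.restrictScalars_apply, map_smul]
  simp only [← map_smul π, ← map_sum]
  congr 1
  ext u
  conv_rhs => rw [← I.sum_lam_antipode_right (ℛ ℂ I.t) (s v u)]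
  simp [e, Finsupp.finsetSum_apply]

lemma trace_eq_zero [Module.Projective H Q] [FiniteDimensional ℂ Q]
    (ht : counit (R := ℂ) I.t = 0) (a : Module.End ℂ Q)
    (ha : ∀ (x : H) (v : Q), a (x • v) = antipode ℂ (antipode ℂ x) • a v) :
    LinearMap.trace ℂ Q a = 0 := by
  obtain ⟨θ, hθ⟩ := I.exists_average_eq_id (Q := Q)
  let ρ := Algebra.lsmul ℂ ℂ Q (A := H)
  have hρ : ∀ x, a * ρ x = ρ (antipode ℂ (antipode ℂ x)) * a := fun x => LinearMap.ext (ha x)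
  have h1 : a = ∑ i ∈ (ℛ ℂ I.t).index, ρ (antipode ℂ (antipode ℂ ((ℛ ℂ I.t).left i))) *
      (a * θ * ρ (antipode ℂ ((ℛ ℂ I.t).right i))) := by
    simp only [← mul_assoc, ← hρ]
    simp only [mul_assoc, ← Finset.mul_sum]
    conv_lhs => rw [← mul_one a]
    congr 1
    ext v
    have := congr($hθ v)
    rw [average_apply] at this
    rw [LinearMap.sum_apply]
    exact this.symm
  rw [h1, map_sum]
  simp only [LinearMap.trace_mul_comm ℂ (ρ _)]
  simp only [mul_assoc, ← map_mul, ← antipode_mul_antidistrib]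
  rw [← map_sum, ← Finset.mul_sum, ← Finset.mul_sum, ← map_sum, ← map_sum,
    sum_antipode_mul_eq_smul, ht]
  simp

end IntegralPair

end Modules

section RootsOfUnity

lemma sum_pow_eq_zero_of_coprime {ι : Type*} [Fintype ι] {n k : ℕ} (hn : n ≠ 0) (hk : k.Coprime n)
    {ζ : ι → ℂ} (hζ : ∀ i, ζ i ^ n = 1) (h0 : ∑ i, ζ i = 0) : ∑ i, ζ i ^ k = 0 := by
  have : NeZero n := ⟨hn⟩
  have hη := Complex.isPrimitiveRoot_exp n hn
  set η := Complex.exp (2 * Real.pi * Complex.I / n)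
  choose e _ he using fun i => hη.eq_pow_of_pow_eq_one (hζ i)
  let P : Polynomial ℤ := ∑ i, Polynomial.X ^ e i
  have hP : ∀ z : ℂ, Polynomial.aeval z P = ∑ i, z ^ e i := by simp [P]
  have h1 : minpoly ℤ η ∣ P :=
    minpoly.isIntegrallyClosed_dvd (hη.isIntegral (Nat.pos_of_ne_zero hn)) (by simp [hP, he, h0])
  rw [hη.minpoly_eq_pow_coprime hk] at h1
  have h2 := Polynomial.aeval_eq_zero_of_dvd_aeval_eq_zero h1 (minpoly.aeval ℤ (η ^ k))
  simpa [hP, ← he, pow_right_comm] using h2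

lemma exists_odd_sum_pow_ne_zero {d : ℕ} (hd : Odd d) {ζ : Fin d → ℂ} (hζ : ∀ i, ζ i ≠ 0) :
    ∃ k ≤ d, Odd k ∧ ∑ i, ζ i ^ k ≠ 0 := by
  by_contra! hc
  have key : ∀ k ≤ d, Odd k → MvPolynomial.aeval ζ (MvPolynomial.esymm (Fin d) ℂ k) = 0 := by
    intro k
    induction k using Nat.strong_induction_on with
    | _ k ih =>
      intro hkd hk
      have h1 := congr(MvPolynomial.aeval ζ $(MvPolynomial.mul_esymm_eq_sum (Fin d) ℂ k))
      rw [map_mul, map_natCast, map_mul, map_sum, Finset.sum_eq_zero, mul_zero] at h1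
      · exact (mul_eq_zero.1 h1).resolve_left (by exact_mod_cast hk.pos.ne')
      · rintro ⟨i, j⟩ hij
        obtain ⟨hij, hi⟩ := Finset.mem_filter.1 hij
        rw [Finset.HasAntidiagonal.mem_antidiagonal] at hij
        simp only at hij hi ⊢
        rcases Nat.even_or_odd i with hi2 | hi2
        · have hj : Odd j := by
            rcases Nat.even_or_odd j with hj | hj
            · exact absurd hk (by rw [← hij, Nat.not_odd_iff_even]; exact hi2.add hj)
            · exact hj
          simp [MvPolynomial.psum, hc j (by omega) hj]
        · rw [map_mul, map_mul, ih i hi (by omega) hi2, mul_zero, zero_mul]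
  have h2 := key d le_rfl hd
  have h3 : Finset.powersetCard d (Finset.univ : Finset (Fin d)) = {Finset.univ} := by
    simpa using Finset.powersetCard_self (Finset.univ : Finset (Fin d))
  simp [MvPolynomial.esymm, h3, Finset.prod_eq_zero_iff, hζ] at h2

lemma le_of_sum_eq_zero {p q d : ℕ} (hp : p.Prime) (hq : q.Prime) (hpq : p < q) (hd : Odd d)
    {ζ : Fin d → ℂ} (hζ : ∀ i, ζ i ^ (2 * (p * q)) = 1) (h0 : ∑ i, ζ i = 0) : p ≤ d := by
  by_contra! hlt
  have hn : 2 * (p * q) ≠ 0 := by simp [hp.ne_zero, hq.ne_zero]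
  obtain ⟨k, hkd, hk, hne⟩ := exists_odd_sum_pow_ne_zero hd (ζ := ζ) fun i hi => by
    simpa [hi, hn] using hζ i
  refine hne (sum_pow_eq_zero_of_coprime hn ?_ hζ h0)
  have hk2 : k.Coprime 2 := Nat.coprime_two_right.2 hk
  have hkr : ∀ r, r.Prime → k < r → k.Coprime r := fun r hr hkr =>
    ((Nat.Prime.coprime_iff_not_dvd hr).2 fun h => absurd (Nat.le_of_dvd hk.pos h) (by omega)).symm
  exact hk2.mul_right ((hkr p hp (by omega)).mul_right (hkr q hq (by omega)))

end RootsOfUnity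

section Indecomposable

variable {H : Type*} [Ring H] [Algebra ℂ H]
  {Q : Type*} [AddCommGroup Q] [Module ℂ Q] [Module H Q] [IsScalarTower ℂ H Q]
  [FiniteDimensional ℂ Q]

/-- An endomorphism of an indecomposable module has only one eigenvalue. -/
lemma eq_of_hasEigenvalue
    (hindec : ¬ ∃ A B : Submodule H Q, A ≠ ⊥ ∧ B ≠ ⊥ ∧ IsCompl A B) (f : Q →ₗ[H] Q) {c z : ℂ}
    (hc : Module.End.HasEigenvalue (f.restrictScalars ℂ) c)
    (hz : Module.End.HasEigenvalue (f.restrictScalars ℂ) z) : z = c := by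
  have : IsNoetherian H Q := isNoetherian_of_tower ℂ inferInstance
  have : IsArtinian H Q := isArtinian_of_tower ℂ inferInstance
  let u : Module.End H Q := f - c • LinearMap.id
  have hu : ∀ {y : ℂ} {v : Q}, Module.End.HasEigenvector (f.restrictScalars ℂ) y v →
      ∀ m : ℕ, (u ^ m) v = (y - c) ^ m • v := by
    intro y v hv m
    have h1 : f v = y • v := hv.apply_eq_smul
    induction m with
    | zero => simp
    | succ m ih =>
      rw [pow_succ, Module.End.mul_apply]
      have h2 : u v = (y - c) • v := by simp [u, h1, sub_smul]
      rw [h2, LinearMap.map_smul_of_tower, ih, smul_smul, pow_succ']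
  have hcompl := LinearMap.isCompl_iSup_ker_pow_iInf_range_pow u
  obtain ⟨v, hv⟩ := hc.exists_hasEigenvector
  obtain ⟨w, hw⟩ := hz.exists_hasEigenvector
  have hK : (⨆ n, LinearMap.ker (u ^ n)) ≠ ⊥ := fun hbot => hv.2 <| by
    have : v ∈ LinearMap.ker (u ^ 1) := by rw [LinearMap.mem_ker, hu hv]; simp
    simpa [hbot] using Submodule.mem_iSup_of_mem (p := fun n => LinearMap.ker (u ^ n)) 1 this
  have hR : (⨅ n, LinearMap.range (u ^ n)) = ⊥ := by
    by_contra hne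
    exact hindec ⟨_, _, hK, hne, hcompl⟩
  rw [hR] at hcompl
  have htop : w ∈ ⨆ n, LinearMap.ker (u ^ n) := by
    rw [eq_top_of_isCompl_bot hcompl]
    trivial
  rw [Submodule.mem_iSup_of_directed _
    (monotone_nat_of_le_succ fun n => LinearMap.ker_le_ker_comp _ u |>.trans
      (by rw [pow_succ']; rfl)).directed_le] at htop
  obtain ⟨m, hm⟩ := htop
  rw [LinearMap.mem_ker, hu hw] at hm
  exact sub_eq_zero.1 (eq_zero_of_pow_eq_zero ((smul_eq_zero.1 hm).resolve_right hw.2))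

end Indecomposable

section OddDimension

lemma le_card_of_sum_eq_zero {p q : ℕ} (hp : p.Prime) (hq : q.Prime) (hpq : p < q)
    {s : Multiset ℂ} (hs : Odd (Multiset.card s)) (h0 : (0 : ℂ) ∉ s)
    (hpow : ∀ z ∈ s, ∀ w ∈ s, z ^ (2 * (p * q)) = w ^ (2 * (p * q))) (hsum : s.sum = 0) :
    p ≤ Multiset.card s := by
  obtain ⟨l, rfl⟩ := Quot.exists_rep s
  change (l : Multiset ℂ).sum = 0 at hsum
  change Odd l.length at hs
  change p ≤ l.length
  change (0 : ℂ) ∉ (l : Multiset ℂ) at h0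
  change ∀ z ∈ (l : Multiset ℂ), ∀ w ∈ (l : Multiset ℂ), _ at hpow
  simp only [Multiset.mem_coe, Multiset.sum_coe] at h0 hpow hsum
  have hw := l.get_mem ⟨0, hs.pos⟩
  set w := l.get ⟨0, hs.pos⟩
  have hw0 : w ≠ 0 := fun h => h0 (h ▸ hw)
  refine le_of_sum_eq_zero hp hq hpq hs (ζ := fun i => l.get i / w) (fun i => ?_) ?_
  · rw [div_pow, hpow _ (l.get_mem i) w hw, div_self (pow_ne_zero _ hw0)]
  · rw [← Finset.sum_div, ← List.sum_ofFn, List.ofFn_get, hsum, zero_div]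

variable {H : Type*} [Ring H] [HopfAlgebra ℂ H]
  {Q : Type*} [AddCommGroup Q] [Module ℂ Q] [Module H Q]

lemma pow_apply_smul {a : Module.End ℂ Q}
    (ha : ∀ (x : H) (v : Q), a (x • v) = (antipode ℂ * antipode ℂ : Module.End ℂ H) x • a v)
    (k : ℕ) (x : H) (v : Q) :
    (a ^ k) (x • v) = ((antipode ℂ * antipode ℂ : Module.End ℂ H) ^ k) x • (a ^ k) v := by
  induction k with
  | zero => simp
  | succ k ih => simp only [pow_succ', Module.End.mul_apply a, ih, ha, Module.End.mul_apply (_ * _)]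

variable [IsScalarTower ℂ H Q] [FiniteDimensional ℂ H] [FiniteDimensional ℂ Q]

/-- All eigenvalues of an isomorphism `Q ≅ Q**`, with `Q` indecomposable, have the same power of
exponent `2 dim H`. -/
lemma pow_eq_pow_of_hasEigenvalue
    (hindec : ¬ ∃ A B : Submodule H Q, A ≠ ⊥ ∧ B ≠ ⊥ ∧ IsCompl A B) {a : Module.End ℂ Q}
    (ha : ∀ (x : H) (v : Q), a (x • v) = (antipode ℂ * antipode ℂ : Module.End ℂ H) x • a v)
    {z w : ℂ} (hz : a.HasEigenvalue z) (hw : a.HasEigenvalue w) :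
    z ^ (2 * Module.finrank ℂ H) = w ^ (2 * Module.finrank ℂ H) := by
  let f : Q →ₗ[H] Q :=
    { (a ^ (2 * Module.finrank ℂ H)) with
      map_smul' := fun x v => by
        have := pow_apply_smul ha (2 * Module.finrank ℂ H) x v
        rwa [antipode_pow_eq_one] at this }
  have hf : f.restrictScalars ℂ = a ^ (2 * Module.finrank ℂ H) := rfl
  exact eq_of_hasEigenvalue hindec f
    (by rw [hf]; exact hw.pow _) (by rw [hf]; exact hz.pow _)

end OddDimension

end HopfInt

/-- For a non-semisimple Hopf algebra `H` over `ℂ` of dimension `p·q`, where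
`p < q ≤ 2p + 1` are odd primes, any odd-dimensional indecomposable projective
`H`-module `Q` with `Q ≅ Q**` (i.e. admitting a `ℂ`-linear automorphism `a` with
`a (x • v) = S²(x) • a v`) satisfies `dim Q ≥ p`. -/
theorem odd_self_bidual_projective_dim_ge (p q : ℕ) (hp : p.Prime) (hq : q.Prime)
    (hpodd : Odd p) (hqodd : Odd q) (hpq : p < q) (hq2p : q ≤ 2 * p + 1)
    (H : Type) [Ring H] [HopfAlgebra ℂ H]
    (hdim : Module.finrank ℂ H = p * q)
    (hns : ¬ IsSemisimpleRing H)
    (Q : Type) [AddCommGroup Q] [Module ℂ Q] [Module H Q] [IsScalarTower ℂ H Q]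
    [FiniteDimensional ℂ Q] (hQnt : Nontrivial Q)
    (hindec : ¬ ∃ A B : Submodule H Q, A ≠ ⊥ ∧ B ≠ ⊥ ∧ IsCompl A B)
    (hproj : Module.Projective H Q)
    (hodd : Odd (Module.finrank ℂ Q))
    (a : Q ≃ₗ[ℂ] Q)
    (ha : ∀ (x : H) (v : Q),
      a (x • v) =
        (((HopfAlgebra.antipode (R := ℂ) (A := H) : Module.End ℂ H) ^ 2) x) • a v) :
    p ≤ Module.finrank ℂ Q := by
  have hpos : 0 < p * q := Nat.mul_pos hp.pos hq.pos
  have : FiniteDimensional ℂ H := Module.finite_of_finrank_pos (hdim ▸ hpos)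
  obtain ⟨I⟩ := HopfInt.IntegralPair.nonempty (H := H)
  have ht : Coalgebra.counit (R := ℂ) I.t = 0 := by
    by_contra h
    exact hns (I.isSemisimpleRing_of_counit_ne_zero h)
  have hsum := I.trace_eq_zero ht a.toLinearMap ha
  rw [Module.End.trace_eq_sum_roots_charpoly_of_splits (IsAlgClosed.splits _)] at hsum
  have hev := fun z => HopfInt.hasEigenvalue_of_mem_roots_charpoly (W := a.toLinearMap) (z := z)
  rw [← HopfInt.card_roots_charpoly a.toLinearMap] at hodd ⊢
  refine HopfInt.le_card_of_sum_eq_zero hp hq hpq hodd (fun h0 => ?_) (fun z hz w hw => ?_) hsum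
  · obtain ⟨v, hv⟩ := (hev 0 h0).exists_hasEigenvector
    exact hv.2 (a.map_eq_zero_iff.1 (hv.apply_eq_smul.trans (zero_smul ℂ v)))
  · rw [← hdim]
    exact HopfInt.pow_eq_pow_of_hasEigenvalue hindec ha (hev z hz) (hev w hw)
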